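/- Let f be an orientation-preserving circle homeomorphism with irrational rotation number α = [a_1, a_2, …] and unique invariant Borel probability measure μ, let x_0 ∈ S^1, and let P_n = P_n(x_0) be the associated dynamical partitions. Suppose α ∈ D_τ for some τ ≥ 0, and suppose there exist M > 1 and a natural number n_0 such that for all n ≥ n_0 every atom I of P_n has Lebesgue length |I| > M^{−n}/(a_1 a_2 ⋯ a_n)^2. Then dim_H(μ) ≥ 1/(2τ + ν_1 + ν_2 log M), where ν_1 = limsup_{n→∞} 2 log(a_1 a_2 ⋯ a_n)/log q_n and ν_2 = limsup_{n→∞} n/log q_n. -/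

import Mathlib

open MeasureTheory Set Filter
open scoped ENNReal NNReal

noncomputable section

/-- The circle `S¹ = ℝ/ℤ`. -/
abbrev Circle1 := AddCircle (1 : ℝ)

/-- Projection `ℝ → S¹`. -/
def projC (x : ℝ) : Circle1 := (x : Circle1)

/-- An orientation-preserving circle homeomorphism, given together with a
(strictly monotone, continuous) lift `F : ℝ → ℝ` satisfying `F (x+1) = F x + 1`. -/
structure CircleHomeo where
  toHomeo : Circle1 ≃ₜ Circle1
  lift : ℝ → ℝ
  lift_strictMono : StrictMono lift
  lift_continuous : Continuous lift
  lift_add_one : ∀ x : ℝ, lift (x + 1) = lift x + 1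
  lift_proj : ∀ x : ℝ, toHomeo (projC x) = projC (lift x)

/-- The underlying map `S¹ → S¹`. -/
def CircleHomeo.toFun (H : CircleHomeo) : Circle1 → Circle1 := H.toHomeo

/-- `α ∈ [0,1)` is the rotation number of `H`: `α = lim Fⁿ(x)/n (mod 1)`. -/
def HasRotationNumber (H : CircleHomeo) (α : ℝ) : Prop :=
  α ∈ Set.Ico (0 : ℝ) 1 ∧ ∃ β : ℝ, Int.fract β = α ∧
    ∀ x : ℝ, Filter.Tendsto (fun n : ℕ => H.lift^[n] x / n) Filter.atTop (nhds β)

/-- `μ` is an invariant Borel probability measure for `H`. -/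
def IsInvProbMeasure (H : CircleHomeo) (μ : Measure Circle1) : Prop :=
  IsProbabilityMeasure μ ∧ μ.map H.toFun = μ

/-- Hausdorff dimension of a measure: `inf {dim_H X : μ X = 1}`. -/
def dimHMeasure (μ : Measure Circle1) : ℝ≥0∞ :=
  ⨅ (X : Set Circle1) (_ : MeasurableSet X) (_ : μ X = 1), dimH X

/-- The set `D(γ,τ)` of Diophantine numbers of type `(γ,τ)`. -/
def DiophClass (γ τ : ℝ) : Set ℝ :=
  {α : ℝ | ∀ p q : ℤ, q ≠ 0 → γ / |(q : ℝ)| ^ (τ + 2) ≤ |α - (p : ℝ) / (q : ℝ)|}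

/-- The set `D_τ = ⋃_{γ > 0} D(γ,τ)`. -/
def DiophTau (τ : ℝ) : Set ℝ := {α : ℝ | ∃ γ > 0, α ∈ DiophClass γ τ}

/-- Iterates of the Gauss map, starting from `α`. -/
def gaussIter (α : ℝ) : ℕ → ℝ
  | 0 => α
  | n + 1 => Int.fract (1 / gaussIter α n)

/-- The `n`-th partial quotient `a_n` (`n ≥ 1`) of the continued fraction of `α`. -/
def cfA (α : ℝ) (n : ℕ) : ℕ := ⌊1 / gaussIter α (n - 1)⌋₊

/-- Denominators of the convergents: `q_0 = 1`, `q_1 = a_1`, `q_n = a_n q_{n-1} + q_{n-2}`. -/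
def cfQ (α : ℝ) : ℕ → ℕ
  | 0 => 1
  | 1 => cfA α 1
  | n + 2 => cfA α (n + 2) * cfQ α (n + 1) + cfQ α n

/-- Positive displacement from `a` to `z` on the circle, a number in `[0,1)`. -/
def circDisp (a z : Circle1) : ℝ := (AddCircle.equivIco 1 0 (z - a)).1

/-- The circle arc `[a, b)`. -/
def arcIco (a b : Circle1) : Set Circle1 := {z : Circle1 | circDisp a z < circDisp a b}

namespace DynPart

/-- `x_i = f^i(x_0)`. -/
def pt (H : CircleHomeo) (x0 : Circle1) (i : ℕ) : Circle1 := H.toFun^[i] x0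

/-- The interval `I_n`: `[x_0, x_{q_n})` for even `n`, `[x_{q_n}, x_0)` for odd `n`. -/
def In (H : CircleHomeo) (α : ℝ) (x0 : Circle1) (n : ℕ) : Set Circle1 :=
  if Even n then arcIco x0 (pt H x0 (cfQ α n)) else arcIco (pt H x0 (cfQ α n)) x0

/-- `I_n^i = f^i(I_n)`. -/
def Ini (H : CircleHomeo) (α : ℝ) (x0 : Circle1) (n i : ℕ) : Set Circle1 :=
  H.toFun^[i] '' In H α x0 n

/-- The dynamical partition `P_n(x_0)`. -/
def part (H : CircleHomeo) (α : ℝ) (x0 : Circle1) (n : ℕ) : Set (Set Circle1) :=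
  {S | ∃ i < cfQ α n, S = Ini H α x0 (n - 1) i} ∪
  {S | ∃ i < cfQ α (n - 1), S = Ini H α x0 n i}

/-- `Δ^{(n)}_{i,j} = I_n^{i + q_{n-1} + j q_n}`. -/
def Δ (H : CircleHomeo) (α : ℝ) (x0 : Circle1) (n i j : ℕ) : Set Circle1 :=
  Ini H α x0 n (i + cfQ α (n - 1) + j * cfQ α n)

end DynPart

/-- `φ` is a `C³` diffeomorphism from the open set `U` onto the open set `V`. -/
def IsC3DiffeoOn (φ : ℝ → ℝ) (U V : Set ℝ) : Prop :=
  IsOpen U ∧ IsOpen V ∧ ContDiffOn ℝ 3 φ U ∧ Set.BijOn φ U V ∧ ∀ x ∈ U, deriv φ x ≠ 0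

/-- `c` is a critical point of power-law type with exponent `p`: in suitable `C³`
coordinates around `c` and `H c`, the map takes the form `x ↦ x |x|^{p-1}`. -/
def IsPowerLawCritPt (H : CircleHomeo) (c p : ℝ) : Prop :=
  ∃ (U V U' V' : Set ℝ) (φ ψ : ℝ → ℝ),
    c ∈ U ∧ H.lift c ∈ U' ∧ (0 : ℝ) ∈ V ∧ (0 : ℝ) ∈ V' ∧
    IsC3DiffeoOn φ U V ∧ IsC3DiffeoOn ψ U' V' ∧
    φ c = 0 ∧ ψ (H.lift c) = 0 ∧ Set.MapsTo H.lift U U' ∧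
    ∀ x ∈ U, ψ (H.lift x) = φ x * |φ x| ^ (p - 1)

/-- A `C³` multicritical circle map: an orientation-preserving `C³` circle
homeomorphism whose critical points are exactly `c_0, …, c_{N-1}` (represented in
`[0,1)`), each of power-law type with criticality `p_i > 1`. -/
structure MulticriticalCircleMap extends CircleHomeo where
  smooth : ContDiff ℝ 3 lift
  N : ℕ
  N_pos : 0 < N
  crit : Fin N → ℝ
  crit_mem : ∀ i, crit i ∈ Set.Ico (0 : ℝ) 1
  crit_inj : Function.Injective crit
  critExp : Fin N → ℝ
  critExp_gt_one : ∀ i, 1 < critExp i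
  crit_powerLaw : ∀ i, IsPowerLawCritPt toCircleHomeo (crit i) (critExp i)
  crit_complete : ∀ x : ℝ, deriv lift x = 0 → ∃ (i : Fin N) (k : ℤ), x = crit i + (k : ℝ)

/-- `z ∈ S¹` is a critical point of `f^m`. -/
def IsCritPtOfIter (f : MulticriticalCircleMap) (m : ℕ) (z : Circle1) : Prop :=
  ∃ x : ℝ, projC x = z ∧ deriv (f.lift^[m]) x = 0

/-- Indices `0 < j < a_{n+1} - 1` such that the closure of `Δ_j^{(n)}` contains a
critical point of `T_n = f^{q_n}`. -/
def critTimesSet (f : MulticriticalCircleMap) (α : ℝ) (x0 : Circle1) (n : ℕ) : Finset ℕ :=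
  @Finset.filter ℕ
    (fun j => ∃ z ∈ closure (DynPart.Δ f.toCircleHomeo α x0 n 0 j),
      IsCritPtOfIter f (cfQ α n) z)
    (Classical.decPred _)
    (Finset.Ioo 0 (cfA α (n + 1) - 1))

/-- The number `r_n` of bridges (`r_n = #{interior critical times} + 1`). -/
def rn (f : MulticriticalCircleMap) (α : ℝ) (x0 : Circle1) (n : ℕ) : ℕ :=
  (critTimesSet f α x0 n).card + 1

/-- The critical times `0 = k_0^{(n)} < k_1^{(n)} < … < k_{r_n}^{(n)} = a_{n+1} - 1`. -/
def kTime (f : MulticriticalCircleMap) (α : ℝ) (x0 : Circle1) (n : ℕ) (s : ℕ) : ℕ :=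
  (((0 : ℕ) :: (critTimesSet f α x0 n).sort (· ≤ ·)) ++ [cfA α (n + 1) - 1]).getD s
    (cfA α (n + 1) - 1)

/-- The `s`-th bridge `G_s^{(n)} = ⋃_{k_s < j < k_{s+1}} Δ_j^{(n)}`. -/
def bridge (f : MulticriticalCircleMap) (α : ℝ) (x0 : Circle1) (n s : ℕ) : Set Circle1 :=
  ⋃ j ∈ Set.Ioo (kTime f α x0 n s) (kTime f α x0 n (s + 1)),
    DynPart.Δ f.toCircleHomeo α x0 n 0 j

/-- The trimmed bridge `G_{s,γ}^{(n)}`. -/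
def bridgeGamma (f : MulticriticalCircleMap) (α : ℝ) (x0 : Circle1) (n : ℕ) (γ : ℝ)
    (s : ℕ) : Set Circle1 :=
  ⋃ j ∈ {j : ℕ | (kTime f α x0 n s : ℝ) + (cfA α (n + 1) : ℝ) ^ γ < (j : ℝ) ∧
      (j : ℝ) < (kTime f α x0 n (s + 1) : ℝ) + 1 - (cfA α (n + 1) : ℝ) ^ γ},
    DynPart.Δ f.toCircleHomeo α x0 n 0 j

/-- `A^n_{i,γ} = ⋃_{s < r_n} f^i(G_{s,γ}^{(n)})`. -/
def Aset (f : MulticriticalCircleMap) (α : ℝ) (x0 : Circle1) (n i : ℕ) (γ : ℝ) :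
    Set Circle1 :=
  ⋃ s ∈ Set.Iio (rn f α x0 n), f.toCircleHomeo.toFun^[i] '' bridgeGamma f α x0 n γ s

/-- `A^n_γ = ⋃_{i < q_n} A^n_{i,γ}`. -/
def AsetAll (f : MulticriticalCircleMap) (α : ℝ) (x0 : Circle1) (n : ℕ) (γ : ℝ) :
    Set Circle1 :=
  ⋃ i ∈ Set.Iio (cfQ α n), Aset f α x0 n i γ

/-- The Schwarzian derivative `Sf = f'''/f' - (3/2)(f''/f')²`. -/
def schwarzianAt (f : ℝ → ℝ) (x : ℝ) : ℝ :=
  iteratedDeriv 3 f x / deriv f x - 3 / 2 * (iteratedDeriv 2 f x / deriv f x) ^ 2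

end

/-! ### Continued fractions -/

section ContinuedFraction

variable {α : ℝ}

lemma irrational_gaussIter (h : Irrational α) (n : ℕ) : Irrational (gaussIter α n) := by
  induction n with
  | zero => exact h
  | succ n ih =>
    have h1 : Irrational (1 / gaussIter α n) := by rw [one_div]; exact ih.inv
    exact h1.sub_intCast ⌊1 / gaussIter α n⌋

lemma gaussIter_mem_Ioo (h : Irrational α) (hα : α ∈ Set.Ico (0 : ℝ) 1) (n : ℕ) :
    gaussIter α n ∈ Set.Ioo (0 : ℝ) 1 := by
  have h0 : 0 ≤ gaussIter α n ∧ gaussIter α n < 1 := by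
    cases n with
    | zero => exact hα
    | succ n => exact ⟨Int.fract_nonneg _, Int.fract_lt_one _⟩
  exact ⟨lt_of_le_of_ne h0.1 (irrational_gaussIter h n).ne_zero.symm, h0.2⟩

lemma gaussIter_succ_eq (h : Irrational α) (hα : α ∈ Set.Ico (0 : ℝ) 1) (n : ℕ) :
    gaussIter α (n + 1) = 1 / gaussIter α n - cfA α (n + 1) := by
  have hpos := (gaussIter_mem_Ioo h hα n).1
  have h1 : (cfA α (n + 1) : ℝ) = (⌊1 / gaussIter α n⌋ : ℤ) := by
    rw [cfA, Nat.add_sub_cancel, natCast_floor_eq_intCast_floor (by positivity)]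
  rw [h1]
  rfl

lemma one_le_cfA (h : Irrational α) (hα : α ∈ Set.Ico (0 : ℝ) 1) (n : ℕ) : 1 ≤ cfA α n := by
  have hg := gaussIter_mem_Ioo h hα (n - 1)
  rw [cfA, Nat.one_le_floor_iff, le_div_iff₀ hg.1]
  linarith [hg.2]

lemma cfQ_succ_succ (n : ℕ) : cfQ α (n + 2) = cfA α (n + 2) * cfQ α (n + 1) + cfQ α n := rfl

lemma cfQ_pos (h : Irrational α) (hα : α ∈ Set.Ico (0 : ℝ) 1) (n : ℕ) : 0 < cfQ α n := by
  induction n using Nat.twoStepInduction with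
  | zero => simp [cfQ]
  | one => exact one_le_cfA h hα 1
  | more n ih _ => rw [cfQ_succ_succ]; omega

lemma cfA_mul_cfQ_le (n : ℕ) : cfA α (n + 1) * cfQ α n ≤ cfQ α (n + 1) := by
  cases n with
  | zero => simp [cfQ]
  | succ n => exact Nat.le_add_right _ _

lemma cfQ_le_succ (h : Irrational α) (hα : α ∈ Set.Ico (0 : ℝ) 1) (n : ℕ) :
    cfQ α n ≤ cfQ α (n + 1) :=
  (Nat.le_mul_of_pos_left _ (one_le_cfA h hα (n + 1))).trans (cfA_mul_cfQ_le n)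

lemma prod_cfA_le_cfQ (n : ℕ) : ∏ m ∈ Finset.Icc 1 n, cfA α m ≤ cfQ α n := by
  induction n with
  | zero => simp [cfQ]
  | succ n ih =>
    rw [Finset.prod_Icc_succ_top (by omega), mul_comm]
    exact (Nat.mul_le_mul_left _ ih).trans (cfA_mul_cfQ_le n)

lemma two_pow_le_cfQ_sq (h : Irrational α) (hα : α ∈ Set.Ico (0 : ℝ) 1) (n : ℕ) :
    2 ^ n ≤ 2 * cfQ α n ^ 2 := by
  induction n using Nat.twoStepInduction with
  | zero => simp [cfQ]
  | one =>
    have := cfQ_pos h hα 1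
    nlinarith
  | more n ih _ =>
    have h1 : 2 * cfQ α n ≤ cfQ α (n + 2) := by
      rw [cfQ_succ_succ]
      have h2 := Nat.le_mul_of_pos_left (cfQ α (n + 1)) (one_le_cfA h hα (n + 2))
      have h3 := cfQ_le_succ h hα n
      omega
    calc 2 ^ (n + 2) = 4 * 2 ^ n := by ring
      _ ≤ 4 * (2 * cfQ α n ^ 2) := by gcongr
      _ = 2 * (2 * cfQ α n) ^ 2 := by ring
      _ ≤ _ := by gcongr

/-- The product of the first `n + 1` Gauss iterates, which equals `|q_n α - p_n|`. -/
noncomputable def gaussProd (α : ℝ) (n : ℕ) : ℝ := ∏ i ∈ Finset.range (n + 1), gaussIter α i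

lemma gaussProd_succ (n : ℕ) : gaussProd α (n + 1) = gaussProd α n * gaussIter α (n + 1) :=
  Finset.prod_range_succ _ _

lemma gaussProd_pos (h : Irrational α) (hα : α ∈ Set.Ico (0 : ℝ) 1) (n : ℕ) :
    0 < gaussProd α n :=
  Finset.prod_pos fun i _ => (gaussIter_mem_Ioo h hα i).1

lemma gaussProd_succ_succ (h : Irrational α) (hα : α ∈ Set.Ico (0 : ℝ) 1) (n : ℕ) :
    gaussProd α (n + 2) = gaussProd α n - cfA α (n + 2) * gaussProd α (n + 1) := by
  have h1 := (gaussIter_mem_Ioo h hα (n + 1)).1.ne'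
  rw [gaussProd_succ (n + 1), gaussProd_succ n, gaussIter_succ_eq h hα (n + 1)]
  field_simp

lemma gaussProd_one (h : Irrational α) (hα : α ∈ Set.Ico (0 : ℝ) 1) :
    gaussProd α 1 = 1 - cfA α 1 * α := by
  have h1 : gaussIter α 0 = α := rfl
  have h2 : gaussProd α 0 = α := by simp [gaussProd, h1]
  rw [gaussProd_succ 0, gaussIter_succ_eq h hα 0, h1, h2]
  have := h.ne_zero
  field_simp

lemma cfQ_mul_gaussProd_add (h : Irrational α) (hα : α ∈ Set.Ico (0 : ℝ) 1) (n : ℕ) :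
    cfQ α (n + 1) * gaussProd α n + cfQ α n * gaussProd α (n + 1) = 1 := by
  induction n with
  | zero =>
    rw [gaussProd_one h hα]
    simp [cfQ, gaussProd, gaussIter]
  | succ n ih =>
    rw [cfQ_succ_succ, gaussProd_succ_succ h hα]
    push_cast
    linarith

lemma gaussProd_le (h : Irrational α) (hα : α ∈ Set.Ico (0 : ℝ) 1) (n : ℕ) :
    gaussProd α n ≤ 1 / cfQ α (n + 1) := by
  have h1 := cfQ_mul_gaussProd_add h hα n
  have h2 := gaussProd_pos h hα (n + 1)
  have h3 : (0 : ℝ) < cfQ α (n + 1) := by exact_mod_cast cfQ_pos h hα (n + 1)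
  rw [le_div_iff₀ h3]
  have : 0 ≤ cfQ α n * gaussProd α (n + 1) := by positivity
  linarith

lemma gaussProd_mem_Ioo (h : Irrational α) (hα : α ∈ Set.Ico (0 : ℝ) 1) (n : ℕ) :
    gaussProd α n ∈ Set.Ioo (0 : ℝ) 1 := by
  refine ⟨gaussProd_pos h hα n, ?_⟩
  induction n with
  | zero => simpa [gaussProd, gaussIter] using hα.2
  | succ n ih =>
    rw [gaussProd_succ]
    exact mul_lt_one_of_nonneg_of_lt_one_left (gaussProd_pos h hα n).le ih
      (gaussIter_mem_Ioo h hα _).2.le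

lemma exists_int_gaussProd (h : Irrational α) (hα : α ∈ Set.Ico (0 : ℝ) 1) (n : ℕ) :
    ∃ p : ℤ, (-1) ^ n * gaussProd α n = cfQ α n * α - p := by
  induction n using Nat.twoStepInduction with
  | zero => exact ⟨0, by simp [gaussProd, gaussIter, cfQ]⟩
  | one => exact ⟨1, by rw [gaussProd_one h hα]; simp [cfQ]⟩
  | more n ih1 ih2 =>
    obtain ⟨p, hp⟩ := ih1
    obtain ⟨p', hp'⟩ := ih2
    refine ⟨p + cfA α (n + 2) * p', ?_⟩
    rw [gaussProd_succ_succ h hα, cfQ_succ_succ]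
    push_cast
    rw [pow_succ] at hp' ⊢
    linear_combination hp + cfA α (n + 2) * hp'

lemma cfQ_succ_le_of_mem_diophClass (h : Irrational α) (hα : α ∈ Set.Ico (0 : ℝ) 1) {γ τ : ℝ}
    (hγ : 0 < γ) (hD : α ∈ DiophClass γ τ) (n : ℕ) :
    (cfQ α (n + 1) : ℝ) ≤ (cfQ α n : ℝ) ^ (τ + 1) / γ := by
  obtain ⟨p, hp⟩ := exists_int_gaussProd h hα n
  have hq : (0 : ℝ) < cfQ α n := by exact_mod_cast cfQ_pos h hα n
  have hq' : (0 : ℝ) < cfQ α (n + 1) := by exact_mod_cast cfQ_pos h hα (n + 1)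
  have h1 := hD p (cfQ α n) (by exact_mod_cast hq.ne')
  have h2 : |α - (p : ℝ) / (cfQ α n : ℝ)| = gaussProd α n / cfQ α n := by
    have : α - (p : ℝ) / (cfQ α n : ℝ) = (-1) ^ n * gaussProd α n / cfQ α n := by
      rw [hp]; field_simp
    rw [this, abs_div, abs_mul, abs_pow, abs_neg, abs_one, one_pow, one_mul, abs_of_pos hq,
      abs_of_pos (gaussProd_pos h hα n)]
  simp only [Int.cast_natCast] at h1
  rw [h2, abs_of_pos hq, show τ + 2 = (τ + 1) + 1 by ring, Real.rpow_add_one hq.ne',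
    ← div_div] at h1
  have h3 := ((div_le_div_iff_of_pos_right hq).1 h1).trans (gaussProd_le h hα n)
  have hr : 0 < (cfQ α n : ℝ) ^ (τ + 1) := Real.rpow_pos_of_pos hq _
  rw [div_le_div_iff₀ hr hq'] at h3
  rw [le_div_iff₀ hγ]
  linarith

end ContinuedFraction

/-! ### The averaged ceiling function, a lift of the cumulative distribution function of `μ` -/

section CeilAverage

/-- The representative in `[0, 1)` of a point of the circle. -/
noncomputable def circRep (z : Circle1) : ℝ := (AddCircle.equivIco 1 0 z).1

lemma projC_circRep (z : Circle1) : projC (circRep z) = z := AddCircle.coe_equivIco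

lemma circRep_mem (z : Circle1) : circRep z ∈ Set.Ico (0 : ℝ) 1 :=
  have h := (AddCircle.equivIco 1 0 z).2
  ⟨h.1, h.2.trans_eq (zero_add 1)⟩

lemma measurable_circRep : Measurable circRep :=
  measurable_subtype_coe.comp (AddCircle.measurableEquivIco 1 0).measurable

lemma projC_eq_iff {x y : ℝ} : projC x = projC y ↔ ∃ k : ℤ, x = y + k := by
  rw [← sub_eq_zero, projC, projC, ← AddCircle.coe_sub, AddCircle.coe_eq_zero_iff]
  simp only [zsmul_eq_mul, mul_one]
  exact exists_congr fun k => ⟨fun h => by linarith, fun h => by linarith⟩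

/-- The `μ`-average of `⌈x - t⌉`, where `t` is the representative in `[0, 1)` of the point of
integration. -/
noncomputable def ceilAverage (μ : Measure Circle1) (x : ℝ) : ℝ :=
  ∫ z, ((⌈x - circRep z⌉ : ℤ) : ℝ) ∂μ

variable (μ : Measure Circle1) [IsProbabilityMeasure μ]

lemma measurable_ceil_sub (x : ℝ) : Measurable fun z => ((⌈x - circRep z⌉ : ℤ) : ℝ) :=
  (measurable_of_countable _).comp (Int.measurable_ceil.comp (measurable_circRep.const_sub x))

lemma ceil_sub_circRep_bounds (x : ℝ) (z : Circle1) :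
    x - 1 ≤ ((⌈x - circRep z⌉ : ℤ) : ℝ) ∧ ((⌈x - circRep z⌉ : ℤ) : ℝ) ≤ x + 1 := by
  have h1 := Int.le_ceil (x - circRep z)
  have h2 := Int.ceil_lt_add_one (x - circRep z)
  have h3 := circRep_mem z
  exact ⟨by linarith [h3.2], by linarith [h3.1]⟩

lemma integrable_ceil_sub (x : ℝ) :
    Integrable (fun z => ((⌈x - circRep z⌉ : ℤ) : ℝ)) μ := by
  refine Integrable.of_bound (measurable_ceil_sub x).aestronglyMeasurable (|x| + 1)
    (ae_of_all _ fun z => ?_)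
  have := ceil_sub_circRep_bounds x z
  rw [Real.norm_eq_abs, abs_le]
  constructor <;> linarith [neg_abs_le x, le_abs_self x]

lemma ceilAverage_mono : Monotone (ceilAverage μ) := fun x y hxy =>
  integral_mono (integrable_ceil_sub μ x) (integrable_ceil_sub μ y) fun z => by
    have : ⌈x - circRep z⌉ ≤ ⌈y - circRep z⌉ := Int.ceil_mono (by linarith)
    exact Int.cast_le.2 this

lemma ceilAverage_add_intCast (x : ℝ) (k : ℤ) :
    ceilAverage μ (x + k) = ceilAverage μ x + k := by
  have : ∀ z, ((⌈x + k - circRep z⌉ : ℤ) : ℝ) = ((⌈x - circRep z⌉ : ℤ) : ℝ) + k := fun z => by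
    rw [show x + k - circRep z = (x - circRep z) + k by ring, Int.ceil_add_intCast]
    push_cast; rfl
  simp only [ceilAverage, this]
  rw [integral_add (integrable_ceil_sub μ x) (integrable_const _)]
  simp

lemma ceilAverage_bounds (x : ℝ) : x - 1 ≤ ceilAverage μ x ∧ ceilAverage μ x ≤ x + 1 := by
  constructor
  · have := integral_mono (integrable_const (x - 1)) (integrable_ceil_sub μ x)
      fun z => (ceil_sub_circRep_bounds x z).1
    simpa [ceilAverage] using this
  · have := integral_mono (integrable_ceil_sub μ x) (integrable_const (x + 1))
      fun z => (ceil_sub_circRep_bounds x z).2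
    simpa [ceilAverage] using this

lemma measure_projC_Ico_le (a b : ℝ) :
    μ (projC '' Set.Ico a b) ≤ ENNReal.ofReal (ceilAverage μ b - ceilAverage μ a) := by
  rcases lt_or_ge b a with hab | hab
  · simp [Set.Ico_eq_empty hab.le.not_gt]
  have hsub : ceilAverage μ b - ceilAverage μ a
      = ∫ z, (((⌈b - circRep z⌉ : ℤ) : ℝ) - ((⌈a - circRep z⌉ : ℤ) : ℝ)) ∂μ :=
    (integral_sub (integrable_ceil_sub μ b) (integrable_ceil_sub μ a)).symm
  have hmeas := (measurable_ceil_sub b).sub (measurable_ceil_sub a)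
  have hint : Integrable
      (fun z => ((⌈b - circRep z⌉ : ℤ) : ℝ) - ((⌈a - circRep z⌉ : ℤ) : ℝ)) μ :=
    (integrable_ceil_sub μ b).sub (integrable_ceil_sub μ a)
  rw [hsub, ofReal_integral_eq_lintegral_ofReal hint]
  · refine le_trans ?_ (mul_meas_ge_le_lintegral hmeas.ennreal_ofReal 1)
    rw [one_mul]
    refine measure_mono ?_
    rintro _ ⟨u, hu, rfl⟩
    obtain ⟨m, hm⟩ := projC_eq_iff.1 (projC_circRep (projC u))
    simp only [Set.mem_ofPred_eq, Pi.sub_apply, ENNReal.one_le_ofReal]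
    rw [hm]
    have h1 : ⌈a - (u + m)⌉ ≤ -m := Int.ceil_le.2 (by push_cast; linarith [hu.1])
    have h2 : -m < ⌈b - (u + m)⌉ := Int.lt_ceil.2 (by push_cast; linarith [hu.2])
    have h3 : 1 + ⌈a - (u + m)⌉ ≤ ⌈b - (u + m)⌉ := by omega
    rw [le_sub_iff_add_le]
    exact_mod_cast h3
  · refine ae_of_all _ fun z => ?_
    have : ⌈a - circRep z⌉ ≤ ⌈b - circRep z⌉ := Int.ceil_mono (by linarith)
    simpa using this

namespace CircleHomeo

variable (H : CircleHomeo)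

lemma lift_add_intCast (x : ℝ) (k : ℤ) : H.lift (x + k) = H.lift x + k := by
  induction k using Int.induction_on with
  | zero => simp
  | succ i ih =>
    have := H.lift_add_one (x + i)
    push_cast at ih ⊢
    rw [← add_assoc, this, ih]; ring
  | pred i ih =>
    have := H.lift_add_one (x + (-(i : ℝ) - 1))
    push_cast at ih ⊢
    rw [show x + (-(i : ℝ) - 1) + 1 = x + -i by ring, ih] at this
    linarith

lemma iterate_lift_add_intCast (n : ℕ) (x : ℝ) (k : ℤ) :
    H.lift^[n] (x + k) = H.lift^[n] x + k := by
  induction n with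
  | zero => rfl
  | succ n ih => rw [Function.iterate_succ_apply', ih, lift_add_intCast,
      Function.iterate_succ_apply']

lemma toFun_projC (x : ℝ) : H.toFun (projC x) = projC (H.lift x) := H.lift_proj x

lemma iterate_toFun_projC (n : ℕ) (x : ℝ) : H.toFun^[n] (projC x) = projC (H.lift^[n] x) := by
  induction n with
  | zero => rfl
  | succ n ih => rw [Function.iterate_succ_apply', ih, toFun_projC, Function.iterate_succ_apply']

lemma measurable_toFun : Measurable H.toFun := H.toHomeo.continuous.measurable

lemma ceil_lift_sub_lift (x t : ℝ) : ⌈H.lift x - H.lift t⌉ = ⌈x - t⌉ := by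
  refine eq_of_forall_ge_iff fun m => ?_
  rw [Int.ceil_le, Int.ceil_le, sub_le_iff_le_add', sub_le_iff_le_add', ← lift_add_intCast,
    H.lift_strictMono.le_iff_le]

end CircleHomeo

variable {μ} {H : CircleHomeo}

lemma ceilAverage_lift (hμ : μ.map H.toFun = μ) (x : ℝ) :
    ceilAverage μ (H.lift x) = ceilAverage μ x + (ceilAverage μ (H.lift 0) - ceilAverage μ 0) := by
  have key : ∀ y, ceilAverage μ (H.lift y) - ceilAverage μ y
      = ∫ z, (H.lift (circRep z) - circRep (H.toFun z)) ∂μ := by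
    intro y
    have h1 : ceilAverage μ (H.lift y)
        = ∫ z, ((⌈H.lift y - circRep (H.toFun z)⌉ : ℤ) : ℝ) ∂μ := by
      conv_lhs => rw [ceilAverage, ← hμ]
      exact integral_map H.measurable_toFun.aemeasurable
        (measurable_ceil_sub _).aestronglyMeasurable
    have h2 : Integrable (fun z => ((⌈H.lift y - circRep (H.toFun z)⌉ : ℤ) : ℝ)) μ := by
      have := integrable_ceil_sub μ (H.lift y)
      rw [← hμ] at this
      exact this.comp_measurable H.measurable_toFun
    rw [h1, ceilAverage, ← integral_sub h2 (integrable_ceil_sub μ y)]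
    refine integral_congr_ae (ae_of_all _ fun z => ?_)
    have h3 : projC (H.lift (circRep z)) = projC (circRep (H.toFun z)) := by
      rw [projC_circRep, ← H.toFun_projC, projC_circRep]
    obtain ⟨k, hk⟩ := projC_eq_iff.1 h3
    have h4 : H.lift y - circRep (H.toFun z) = H.lift y - H.lift (circRep z) + k := by
      rw [hk]; ring
    have h5 : ⌈H.lift y - circRep (H.toFun z)⌉ = ⌈y - circRep z⌉ + k := by
      rw [h4, Int.ceil_add_intCast, H.ceil_lift_sub_lift]
    simp only [h5, hk]
    push_cast
    ring
  linarith [key x, key 0]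

lemma ceilAverage_iterate_lift (hμ : μ.map H.toFun = μ) {β : ℝ}
    (hβ : ∀ x : ℝ, Tendsto (fun n : ℕ => H.lift^[n] x / n) atTop (nhds β)) (n : ℕ) (x : ℝ) :
    ceilAverage μ (H.lift^[n] x) = ceilAverage μ x + n * β := by
  set c := ceilAverage μ (H.lift 0) - ceilAverage μ 0 with hc
  have key : ∀ (n : ℕ) (x : ℝ), ceilAverage μ (H.lift^[n] x) = ceilAverage μ x + n * c := by
    intro n x
    induction n with
    | zero => simp
    | succ n ih =>
      rw [Function.iterate_succ_apply', ceilAverage_lift hμ, ih]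
      push_cast
      ring
  have hlim : Tendsto (fun n : ℕ => H.lift^[n] 0 / n) atTop (nhds c) := by
    rw [tendsto_iff_norm_sub_tendsto_zero]
    refine squeeze_zero' (Eventually.of_forall fun _ => norm_nonneg _) ?_
      (tendsto_const_div_atTop_nhds_zero_nat (2 : ℝ))
    filter_upwards [eventually_gt_atTop 0] with n hn
    have hn' : (0 : ℝ) < n := by exact_mod_cast hn
    have h1 := key n 0
    have h2 := ceilAverage_bounds μ (H.lift^[n] 0)
    have h3 := ceilAverage_bounds μ 0
    rw [show H.lift^[n] 0 / n - c = (H.lift^[n] 0 - n * c) / n by field_simp, norm_div,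
      Real.norm_natCast, Real.norm_eq_abs]
    gcongr
    rw [abs_le]
    constructor <;> linarith
  rw [key, tendsto_nhds_unique hlim (hβ 0)]

end CeilAverage

/-! ### Dynamical partitions -/

section DynamicalPartition

lemma toReal_volume_projC_Ico_le {a b : ℝ} (hab : a ≤ b) :
    (volume (projC '' Set.Ico a b)).toReal ≤ b - a := by
  have hsub : projC '' Set.Ico a b ⊆ Metric.closedBall (projC ((a + b) / 2)) ((b - a) / 2) := by
    rintro _ ⟨u, hu, rfl⟩
    rw [Metric.mem_closedBall, dist_eq_norm, projC, projC, ← AddCircle.coe_sub]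
    refine QuotientAddGroup.norm_mk_le_norm.trans ?_
    rw [Real.norm_eq_abs, abs_le]
    constructor <;> linarith [hu.1, hu.2]
  refine ENNReal.toReal_le_of_le_ofReal (by linarith) ((measure_mono hsub).trans ?_)
  rw [AddCircle.volume_closedBall]
  exact ENNReal.ofReal_le_ofReal ((min_le_right _ _).trans (by linarith))

lemma projC_add_circDisp (x : ℝ) (z : Circle1) : projC (x + circDisp (projC x) z) = z := by
  have h : projC (circDisp (projC x) z) = z - projC x := projC_circRep (z - projC x)
  calc projC (x + circDisp (projC x) z) = projC x + projC (circDisp (projC x) z) := rfl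
    _ = z := by rw [h]; abel

lemma arcIco_projC_subset (x : ℝ) (b : Circle1) :
    arcIco (projC x) b ⊆ projC '' Set.Ico x (x + circDisp (projC x) b) := fun z hz =>
  ⟨x + circDisp (projC x) z, ⟨le_add_of_nonneg_right (circRep_mem (z - projC x)).1,
    add_lt_add_right hz x⟩, projC_add_circDisp x z⟩

lemma exists_iterate_image_arcIco_subset (H : CircleHomeo) (i : ℕ) (x y : ℝ) :
    ∃ p : ℤ, x ≤ y + p ∧ y + p ≤ x + 1 ∧
      H.toFun^[i] '' arcIco (projC x) (projC y) ⊆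
        projC '' Set.Ico (H.lift^[i] x) (H.lift^[i] y + p) := by
  obtain ⟨p, hp⟩ := projC_eq_iff.1 (projC_add_circDisp x (projC y))
  have hd := circRep_mem (projC y - projC x)
  change circDisp (projC x) (projC y) ∈ _ at hd
  refine ⟨p, by linarith [hd.1], by linarith [hd.2], ?_⟩
  rintro _ ⟨z, hz, rfl⟩
  obtain ⟨u, hu, rfl⟩ := arcIco_projC_subset x _ hz
  rw [hp] at hu
  refine ⟨H.lift^[i] u, ⟨(H.lift_strictMono.iterate i).monotone hu.1, ?_⟩,
    (H.iterate_toFun_projC i u).symm⟩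
  rw [← H.iterate_lift_add_intCast]
  exact H.lift_strictMono.iterate i hu.2

variable {H : CircleHomeo} {α β : ℝ} {μ : Measure Circle1} [IsProbabilityMeasure μ]

lemma exists_lift_arc (hμ : μ.map H.toFun = μ)
    (hβ : ∀ x : ℝ, Tendsto (fun n : ℕ => H.lift^[n] x / n) atTop (nhds β))
    (x : ℝ) (i j k : ℕ) {u : ℝ} (hu : u ∈ Set.Ioo (0 : ℝ) 1) {m : ℤ}
    (hm : u = (k - j) * β + m) :
    ∃ p : ℤ, (volume (H.toFun^[i] ''
        arcIco (DynPart.pt H (projC x) j) (DynPart.pt H (projC x) k))).toReal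
          ≤ H.lift^[i + k] x + p - H.lift^[i + j] x ∧
      ceilAverage μ (H.lift^[i + k] x + p) = ceilAverage μ (H.lift^[i + j] x) + u := by
  obtain ⟨p, hp1, hp2, hp3⟩ :=
    exists_iterate_image_arcIco_subset H i (H.lift^[j] x) (H.lift^[k] x)
  refine ⟨p, ?_, ?_⟩
  · have hle : H.lift^[i + j] x ≤ H.lift^[i + k] x + p := by
      rw [Function.iterate_add_apply, Function.iterate_add_apply, ← H.iterate_lift_add_intCast]
      exact (H.lift_strictMono.iterate i).monotone hp1
    refine le_trans ?_ (toReal_volume_projC_Ico_le hle)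
    refine ENNReal.toReal_mono (measure_ne_top _ _) (measure_mono ?_)
    rw [DynPart.pt, DynPart.pt, H.iterate_toFun_projC, H.iterate_toFun_projC,
      Function.iterate_add_apply, Function.iterate_add_apply]
    exact hp3
  · have h1 := ceilAverage_mono μ hp1
    have h2 := ceilAverage_mono μ hp2
    have h3 := ceilAverage_add_intCast μ (H.lift^[j] x) 1
    rw [Int.cast_one] at h3
    have key := ceilAverage_iterate_lift hμ hβ
    rw [ceilAverage_add_intCast, key, key] at h1
    rw [h3, ceilAverage_add_intCast, key, key] at h2
    have h4 : p = m := by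
      have h5 : p - m < 1 := by
        have : (p : ℝ) - m < 1 := by nlinarith [hu.1]
        exact_mod_cast this
      have h6 : -1 < p - m := by
        have : (-1 : ℝ) < p - m := by nlinarith [hu.2]
        exact_mod_cast this
      omega
    rw [ceilAverage_add_intCast, key, key, h4, hm]
    push_cast
    ring

lemma exists_lift_Ini (hirr : Irrational α) (hα : α ∈ Set.Ico (0 : ℝ) 1)
    (hβα : Int.fract β = α) (hμ : μ.map H.toFun = μ)
    (hβ : ∀ x : ℝ, Tendsto (fun n : ℕ => H.lift^[n] x / n) atTop (nhds β))
    (x : ℝ) (n i : ℕ) :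
    ∃ p : ℤ, (volume (DynPart.Ini H α (projC x) n i)).toReal
          ≤ H.lift^[if Even n then i + cfQ α n else i] x + p
            - H.lift^[if Even n then i else i + cfQ α n] x ∧
      ceilAverage μ (H.lift^[if Even n then i + cfQ α n else i] x + p)
        = ceilAverage μ (H.lift^[if Even n then i else i + cfQ α n] x) + gaussProd α n := by
  obtain ⟨p, hp⟩ := exists_int_gaussProd hirr hα n
  have hβ' : β = ⌊β⌋ + α := by rw [← hβα, Int.floor_add_fract]
  have hu := gaussProd_mem_Ioo hirr hα n
  by_cases hn : Even n
  · rw [hn.neg_one_pow, one_mul] at hp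
    have := exists_lift_arc hμ hβ x i 0 (cfQ α n) hu (m := -p - cfQ α n * ⌊β⌋)
      (by push_cast; linear_combination hp - cfQ α n * hβ')
    simpa [hn, DynPart.Ini, DynPart.In, DynPart.pt] using this
  · rw [(Nat.not_even_iff_odd.1 hn).neg_one_pow] at hp
    have := exists_lift_arc hμ hβ x i (cfQ α n) 0 hu (m := p + cfQ α n * ⌊β⌋)
      (by push_cast; linear_combination -hp + cfQ α n * hβ')
    simpa [hn, DynPart.Ini, DynPart.In, DynPart.pt] using this

/-- Every left endpoint of an atom of the partition of level `n + 1` is followed, further than the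
minimal length of an atom, by another left endpoint, and the measure in between is at most
`1 / q_{n+1}`. -/
lemma exists_next_endpoint (hirr : Irrational α) (hα : α ∈ Set.Ico (0 : ℝ) 1)
    (hβα : Int.fract β = α) (hμ : μ.map H.toFun = μ)
    (hβ : ∀ x : ℝ, Tendsto (fun n : ℕ => H.lift^[n] x / n) atTop (nhds β))
    (x : ℝ) {n : ℕ} {L : ℝ}
    (hL : ∀ S ∈ DynPart.part H α (projC x) (n + 1), L < (volume S).toReal)
    {j : ℕ} (hj : j < cfQ α (n + 1) + cfQ α n) :
    ∃ k < cfQ α (n + 1) + cfQ α n, ∃ p : ℤ, H.lift^[j] x + L < H.lift^[k] x + p ∧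
      ceilAverage μ (H.lift^[k] x + p) ≤ ceilAverage μ (H.lift^[j] x) + 1 / cfQ α (n + 1) := by
  have hmem : ∀ i < cfQ α (n + 1), DynPart.Ini H α (projC x) n i
      ∈ DynPart.part H α (projC x) (n + 1) := fun i hi => Or.inl ⟨i, hi, rfl⟩
  have hmem' : ∀ i < cfQ α n, DynPart.Ini H α (projC x) (n + 1) i
      ∈ DynPart.part H α (projC x) (n + 1) := fun i hi => Or.inr ⟨i, hi, rfl⟩
  have hg : gaussProd α n ≤ 1 / cfQ α (n + 1) := gaussProd_le hirr hα n
  have hg' : gaussProd α (n + 1) ≤ 1 / cfQ α (n + 1) := by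
    refine le_trans ?_ hg
    rw [gaussProd_succ]
    exact mul_le_of_le_one_right (gaussProd_pos hirr hα n).le
      (gaussIter_mem_Ioo hirr hα _).2.le
  have hlong := exists_lift_Ini hirr hα hβα hμ hβ x n
  have hshort := exists_lift_Ini hirr hα hβα hμ hβ x (n + 1)
  by_cases hn : Even n
  · have hn' : ¬ Even (n + 1) := by simpa [Nat.even_add_one] using hn
    simp only [hn, hn', if_true, if_false] at hlong hshort
    by_cases hjq : j < cfQ α (n + 1)
    · obtain ⟨p, hp1, hp2⟩ := hlong j
      have := hL _ (hmem j hjq)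
      exact ⟨j + cfQ α n, by omega, p, by linarith, by linarith⟩
    · obtain ⟨i, rfl⟩ := Nat.exists_eq_add_of_le' (not_lt.1 hjq)
      obtain ⟨p, hp1, hp2⟩ := hshort i
      have := hL _ (hmem' i (by omega))
      exact ⟨i, by omega, p, by linarith, by linarith⟩
  · have hn' : Even (n + 1) := by simpa [Nat.even_add_one] using hn
    simp only [hn, hn', if_true, if_false] at hlong hshort
    by_cases hjq : j < cfQ α n
    · obtain ⟨p, hp1, hp2⟩ := hshort j
      have := hL _ (hmem' j hjq)
      exact ⟨j + cfQ α (n + 1), by omega, p, by linarith, by linarith⟩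
    · obtain ⟨i, rfl⟩ := Nat.exists_eq_add_of_le' (not_lt.1 hjq)
      obtain ⟨p, hp1, hp2⟩ := hlong i
      have := hL _ (hmem i (by omega))
      exact ⟨i, by omega, p, by linarith, by linarith⟩

lemma ceilAverage_add_le (hirr : Irrational α) (hα : α ∈ Set.Ico (0 : ℝ) 1)
    (hβα : Int.fract β = α) (hμ : μ.map H.toFun = μ)
    (hβ : ∀ x : ℝ, Tendsto (fun n : ℕ => H.lift^[n] x / n) atTop (nhds β))
    (x : ℝ) {n : ℕ} {L : ℝ} (hL0 : 0 < L)
    (hL : ∀ S ∈ DynPart.part H α (projC x) (n + 1), L < (volume S).toReal) (a : ℝ) :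
    ceilAverage μ (a + L) ≤ ceilAverage μ a + 2 / cfQ α (n + 1) := by
  set E : Set ℝ := {y | ∃ j < cfQ α (n + 1) + cfQ α n, ∃ k : ℤ, y = H.lift^[j] x + k}
  have hnext : ∀ y ∈ E, ∃ y' ∈ E, y + L < y' ∧
      ceilAverage μ y' ≤ ceilAverage μ y + 1 / cfQ α (n + 1) := by
    rintro _ ⟨j, hj, k, rfl⟩
    obtain ⟨j', hj', p, h1, h2⟩ := exists_next_endpoint hirr hα hβα hμ hβ x hL hj
    refine ⟨H.lift^[j'] x + ((p + k : ℤ) : ℝ), ⟨j', hj', _, rfl⟩, ?_, ?_⟩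
    · push_cast
      linarith
    · rw [Int.cast_add, ← add_assoc, ceilAverage_add_intCast μ _ k,
        ceilAverage_add_intCast μ (H.lift^[j] x) k]
      linarith
  obtain ⟨y, hy, hya, hmax⟩ : ∃ y ∈ E, y ≤ a ∧ ∀ y' ∈ E, y + L < y' → a < y' := by
    by_contra! hcon
    have hiter : ∀ m : ℕ, ∃ y ∈ E, y ≤ a ∧ x + ⌊a - x⌋ + m * L ≤ y := by
      intro m
      induction m with
      | zero =>
        refine ⟨x + ⌊a - x⌋, ⟨0, ?_, ⌊a - x⌋, rfl⟩, by linarith [Int.floor_le (a - x)], by simp⟩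
        have := cfQ_pos hirr hα n
        omega
      | succ m ih =>
        obtain ⟨y, hy, hya, hym⟩ := ih
        obtain ⟨y', hy', h1, h2⟩ := hcon y hy hya
        refine ⟨y', hy', h2, ?_⟩
        push_cast
        linarith
    obtain ⟨m, hm⟩ := Archimedean.arch (a - (x + ⌊a - x⌋) + 1) hL0
    obtain ⟨y, -, h1, h2⟩ := hiter m
    rw [nsmul_eq_mul] at hm
    linarith
  obtain ⟨y', hy', h1, h2⟩ := hnext y hy
  obtain ⟨y'', -, h3, h4⟩ := hnext y' hy'
  have h5 := ceilAverage_mono μ hya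
  have h6 : ceilAverage μ (a + L) ≤ ceilAverage μ y'' :=
    ceilAverage_mono μ (by linarith [hmax y' hy' h1])
  have h7 : (2 : ℝ) / cfQ α (n + 1) = 1 / cfQ α (n + 1) + 1 / cfQ α (n + 1) := by ring
  linarith

end DynamicalPartition

/-! ### The mass distribution principle and the decay of atoms -/

section Dimension

lemma ofReal_le_dimH_of_ceilAverage_le {μ : Measure Circle1} [IsProbabilityMeasure μ]
    {s C r₀ : ℝ} (hs : 0 < s) (hC : 0 < C) (hr₀ : 0 < r₀)
    (h : ∀ t r : ℝ, 0 < r → r ≤ r₀ → ceilAverage μ (t + r) - ceilAverage μ (t - r) ≤ C * r ^ s)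
    {X : Set Circle1} (hX : μ X ≠ 0) : ENNReal.ofReal s ≤ dimH X := by
  have hle : ENNReal.ofReal C⁻¹ • μ ≤ Measure.hausdorffMeasure s := by
    refine Measure.le_hausdorffMeasure s _ (ENNReal.ofReal (r₀ / 2)) (by simpa using hr₀) ?_
    intro S hS
    rcases S.eq_empty_or_nonempty with rfl | ⟨z, hz⟩
    · simp
    have htop : Metric.ediam S ≠ ⊤ := ne_top_of_le_ne_top ENNReal.ofReal_ne_top hS
    set d := (Metric.ediam S).toReal
    have hd0 : 0 ≤ d := ENNReal.toReal_nonneg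
    have hdS : Metric.ediam S = ENNReal.ofReal d := (ENNReal.ofReal_toReal htop).symm
    have hdr : d ≤ r₀ / 2 := ENNReal.toReal_le_of_le_ofReal (by positivity) hS
    have hr : ∀ r ∈ Set.Ioc d r₀, μ S ≤ ENNReal.ofReal (C * r ^ s) := by
      intro r hr
      have hsub : S ⊆ projC '' Set.Ico (circRep z - r) (circRep z + r) := by
        intro w hw
        have hdist : ‖w - z‖ < r := by
          rw [← dist_eq_norm]
          refine lt_of_le_of_lt ?_ hr.1
          rw [dist_edist]
          exact ENNReal.toReal_mono htop (Metric.edist_le_ediam_of_mem hw hz)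
        obtain ⟨u, hu, hur⟩ := QuotientAddGroup.norm_lt_iff.1 hdist
        rw [Real.norm_eq_abs, abs_lt] at hur
        refine ⟨circRep z + u, ⟨by linarith, by linarith⟩, ?_⟩
        calc projC (circRep z + u) = projC (circRep z) + projC u := rfl
          _ = z + (w - z) := by rw [projC_circRep]; exact congrArg _ hu
          _ = w := by abel
      refine (measure_mono hsub).trans ((measure_projC_Ico_le μ _ _).trans ?_)
      exact ENNReal.ofReal_le_ofReal (h _ r (hd0.trans_lt hr.1) hr.2)
    have hlim : Tendsto (fun r : ℝ => ENNReal.ofReal (C * r ^ s)) (nhdsWithin d (Set.Ioi d))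
        (nhds (ENNReal.ofReal (C * d ^ s))) :=
      ENNReal.tendsto_ofReal (((Real.continuousAt_rpow_const d s (Or.inr hs.le)).tendsto.mono_left
        nhdsWithin_le_nhds).const_mul C)
    have hlast : μ S ≤ ENNReal.ofReal (C * d ^ s) := by
      refine ge_of_tendsto hlim ?_
      filter_upwards [Ioc_mem_nhdsGT (show d < r₀ by linarith)] with r using hr r
    calc (ENNReal.ofReal C⁻¹ • μ) S = ENNReal.ofReal C⁻¹ * μ S := rfl
      _ ≤ ENNReal.ofReal C⁻¹ * ENNReal.ofReal (C * d ^ s) := by gcongr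
      _ = ENNReal.ofReal (d ^ s) := by
        rw [← ENNReal.ofReal_mul (by positivity), inv_mul_cancel_left₀ hC.ne']
      _ = Metric.ediam S ^ s := by rw [hdS, ENNReal.ofReal_rpow_of_nonneg hd0 hs.le]
  refine le_dimH_of_hausdorffMeasure_ne_zero (d := s.toNNReal) ?_
  rw [Real.coe_toNNReal s hs.le]
  intro h0
  have h1 : ENNReal.ofReal C⁻¹ * μ X ≤ 0 := h0 ▸ hle X
  simp only [nonpos_iff_eq_zero, mul_eq_zero, ENNReal.ofReal_eq_zero, not_le.2 (inv_pos.2 hC),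
    false_or] at h1
  exact hX h1

variable {α : ℝ}

lemma log_two_mul_le_log_cfQ (h : Irrational α) (hα : α ∈ Set.Ico (0 : ℝ) 1) (n : ℕ) :
    n * Real.log 2 ≤ Real.log 2 + 2 * Real.log (cfQ α n) := by
  have h1 : (2 : ℝ) ^ n ≤ 2 * (cfQ α n : ℝ) ^ 2 := by exact_mod_cast two_pow_le_cfQ_sq h hα n
  have hq : (0 : ℝ) < cfQ α n := by exact_mod_cast cfQ_pos h hα n
  have h2 := Real.log_le_log (by positivity) h1
  rw [Real.log_pow, Real.log_mul two_ne_zero (by positivity), Real.log_pow] at h2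
  exact_mod_cast h2

lemma log_cfQ_pos (h : Irrational α) (hα : α ∈ Set.Ico (0 : ℝ) 1) {n : ℕ} (hn : 2 ≤ n) :
    0 < Real.log (cfQ α n) := by
  have h1 := log_two_mul_le_log_cfQ h hα n
  have h2 := Real.log_pos one_lt_two
  have h3 : (2 : ℝ) ≤ n := by exact_mod_cast hn
  nlinarith

lemma isBoundedUnder_log_prod_cfA_div (h : Irrational α) (hα : α ∈ Set.Ico (0 : ℝ) 1) :
    IsBoundedUnder (· ≤ ·) atTop (fun n : ℕ =>
      2 * Real.log (∏ m ∈ Finset.Icc 1 n, (cfA α m : ℝ)) / Real.log (cfQ α n)) := by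
  refine isBoundedUnder_of_eventually_le (a := 2) ?_
  filter_upwards [eventually_ge_atTop 2] with n hn
  rw [div_le_iff₀ (log_cfQ_pos h hα hn)]
  have h1 : ∏ m ∈ Finset.Icc 1 n, (cfA α m : ℝ) ≤ cfQ α n := by
    exact_mod_cast prod_cfA_le_cfQ n
  have h2 : 0 < ∏ m ∈ Finset.Icc 1 n, (cfA α m : ℝ) :=
    Finset.prod_pos fun m _ => by exact_mod_cast one_le_cfA h hα m
  linarith [Real.log_le_log h2 h1]

lemma isBoundedUnder_div_log_cfQ (h : Irrational α) (hα : α ∈ Set.Ico (0 : ℝ) 1) :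
    IsBoundedUnder (· ≤ ·) atTop (fun n : ℕ => (n : ℝ) / Real.log (cfQ α n)) := by
  have h2 := Real.log_pos one_lt_two
  refine isBoundedUnder_of_eventually_le (a := 4 / Real.log 2) ?_
  filter_upwards [eventually_ge_atTop 2] with n hn
  have h1 := log_two_mul_le_log_cfQ h hα n
  have h3 : (2 : ℝ) ≤ n := by exact_mod_cast hn
  rw [div_le_div_iff₀ (log_cfQ_pos h hα hn) h2]
  nlinarith

/-- The lower bound `M⁻ⁿ / (a_1 ⋯ a_n)²` on the length of the atoms of level `n`. -/
noncomputable def atomBound (α M : ℝ) (n : ℕ) : ℝ :=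
  M ^ (-(n : ℝ)) / (∏ m ∈ Finset.Icc 1 n, (cfA α m : ℝ)) ^ 2

lemma one_le_prod_cfA (h : Irrational α) (hα : α ∈ Set.Ico (0 : ℝ) 1) (n : ℕ) :
    1 ≤ ∏ m ∈ Finset.Icc 1 n, (cfA α m : ℝ) := by
  have : 1 ≤ ∏ m ∈ Finset.Icc 1 n, cfA α m :=
    Finset.one_le_prod' fun m _ => one_le_cfA h hα m
  exact_mod_cast this

lemma atomBound_pos (h : Irrational α) (hα : α ∈ Set.Ico (0 : ℝ) 1) {M : ℝ} (hM : 1 < M)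
    (n : ℕ) : 0 < atomBound α M n := by
  have := one_le_prod_cfA h hα n
  have : 0 < M := by linarith
  unfold atomBound
  positivity

lemma tendsto_atomBound (h : Irrational α) (hα : α ∈ Set.Ico (0 : ℝ) 1) {M : ℝ} (hM : 1 < M) :
    Tendsto (atomBound α M) atTop (nhds 0) := by
  have hM0 : 0 < M := by linarith
  refine squeeze_zero (fun n => (atomBound_pos h hα hM n).le) (fun n => ?_)
    (tendsto_pow_atTop_nhds_zero_of_lt_one (inv_nonneg.2 hM0.le) (inv_lt_one_of_one_lt₀ hM))
  rw [atomBound, Real.rpow_neg hM0.le, Real.rpow_natCast, inv_pow]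
  exact div_le_self (by positivity) (one_le_pow₀ (one_le_prod_cfA h hα n))

lemma exists_one_div_cfQ_le_atomBound_rpow (h : Irrational α) (hα : α ∈ Set.Ico (0 : ℝ) 1)
    {τ M s : ℝ} (hD : α ∈ DiophTau τ) (hM : 1 < M) (hs : 0 < s)
    (hsκ : s * (2 * τ
        + limsup (fun n : ℕ =>
            2 * Real.log (∏ m ∈ Finset.Icc 1 n, (cfA α m : ℝ)) / Real.log (cfQ α n)) atTop
        + limsup (fun n : ℕ => (n : ℝ) / Real.log (cfQ α n)) atTop * Real.log M) < 1) :
    ∃ C > 0, ∀ᶠ n : ℕ in atTop, 1 / (cfQ α n : ℝ) ≤ C * atomBound α M (n + 1) ^ s := by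
  obtain ⟨γ, hγ, hD⟩ := hD
  set ν₁ := limsup (fun n : ℕ =>
    2 * Real.log (∏ m ∈ Finset.Icc 1 n, (cfA α m : ℝ)) / Real.log (cfQ α n)) atTop
  set ν₂ := limsup (fun n : ℕ => (n : ℝ) / Real.log (cfQ α n)) atTop
  have hlM := Real.log_pos hM
  set κ := 2 * τ + ν₁ + ν₂ * Real.log M with hκ
  set ε := (1 / s - κ) / (1 + Real.log M)
  have hε0 : 0 < ε := by
    refine div_pos (sub_pos.2 ?_) (by linarith)
    rw [lt_div_iff₀ hs]
    linarith
  have hsε : s * (2 * τ + (ν₁ + ε) + (ν₂ + ε) * Real.log M) = 1 := by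
    have h1 : ε * (1 + Real.log M) = 1 / s - κ := div_mul_cancel₀ _ (by linarith)
    have h2 : 2 * τ + (ν₁ + ε) + (ν₂ + ε) * Real.log M = 1 / s := by
      rw [hκ] at h1
      linarith
    rw [h2, mul_one_div_cancel hs.ne']
  refine ⟨Real.exp (s * (Real.log M - 2 * Real.log γ)), Real.exp_pos _, ?_⟩
  filter_upwards [eventually_ge_atTop 2,
    eventually_lt_of_limsup_lt (lt_add_of_pos_right ν₁ hε0) (isBoundedUnder_log_prod_cfA_div h hα),
    eventually_lt_of_limsup_lt (lt_add_of_pos_right ν₂ hε0) (isBoundedUnder_div_log_cfQ h hα)]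
    with n hn h1 h2
  have hlq := log_cfQ_pos h hα hn
  rw [div_lt_iff₀ hlq] at h1 h2
  have hq : (0 : ℝ) < cfQ α n := by exact_mod_cast cfQ_pos h hα n
  have ha : (1 : ℝ) ≤ cfA α (n + 1) := by exact_mod_cast one_le_cfA h hα (n + 1)
  have hP := one_le_prod_cfA h hα n
  have ha0 := zero_lt_one.trans_le ha
  have hP0 := zero_lt_one.trans_le hP
  have hM0 : 0 < M := by linarith
  have hlog_a : Real.log (cfA α (n + 1)) ≤ τ * Real.log (cfQ α n) - Real.log γ := by
    have h3 : (cfA α (n + 1) : ℝ) * cfQ α n ≤ (cfQ α n : ℝ) ^ (τ + 1) / γ :=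
      le_trans (by exact_mod_cast cfA_mul_cfQ_le n) (cfQ_succ_le_of_mem_diophClass h hα hγ hD n)
    have h4 := Real.log_le_log (mul_pos ha0 hq) h3
    rw [Real.log_mul ha0.ne' hq.ne', Real.log_div (Real.rpow_pos_of_pos hq _).ne' hγ.ne',
      Real.log_rpow hq] at h4
    linarith
  have hlogL : Real.log (atomBound α M (n + 1)) = -((n + 1) * Real.log M
      + 2 * Real.log (∏ m ∈ Finset.Icc 1 n, (cfA α m : ℝ))
      + 2 * Real.log (cfA α (n + 1))) := by
    rw [atomBound, Finset.prod_Icc_succ_top (by omega),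
      Real.log_div (Real.rpow_pos_of_pos hM0 _).ne' (pow_pos (mul_pos hP0 ha0) 2).ne',
      Real.log_rpow hM0, Real.log_pow, Real.log_mul hP0.ne' ha0.ne']
    push_cast
    ring
  rw [Real.rpow_def_of_pos (atomBound_pos h hα hM _), ← Real.exp_add, one_div,
    ← Real.exp_log (inv_pos.2 hq), Real.log_inv, Real.exp_le_exp, hlogL]
  have h5 : n * Real.log M ≤ (ν₂ + ε) * Real.log (cfQ α n) * Real.log M :=
    mul_le_mul_of_nonneg_right h2.le hlM.le
  have h6 : (n + 1) * Real.log M + 2 * Real.log (∏ m ∈ Finset.Icc 1 n, (cfA α m : ℝ))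
      + 2 * Real.log (cfA α (n + 1)) ≤ (Real.log M - 2 * Real.log γ)
        + (2 * τ + (ν₁ + ε) + (ν₂ + ε) * Real.log M) * Real.log (cfQ α n) := by
    linarith
  have h7 := mul_le_mul_of_nonneg_left h6 hs.le
  rw [mul_add s (Real.log M - 2 * Real.log γ), ← mul_assoc s (_ + _), hsε, one_mul] at h7
  linarith

lemma exists_succ_lt_le_of_tendsto_zero {u : ℕ → ℝ} (hu : Tendsto u atTop (nhds 0)) {r : ℝ}
    (hr : 0 < r) {N : ℕ} (hN : r ≤ u N) : ∃ n ≥ N, u (n + 1) < r ∧ r ≤ u n := by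
  have hex : ∃ m, u (N + m) < r := by
    obtain ⟨m, hm, hmN⟩ := ((hu.eventually_lt_const hr).and (eventually_ge_atTop N)).exists
    exact ⟨m - N, by rwa [Nat.add_sub_cancel' hmN]⟩
  classical
  obtain ⟨m, hm⟩ := Nat.exists_eq_succ_of_ne_zero
    (show Nat.find hex ≠ 0 from fun h0 => by
      have := Nat.find_spec hex
      rw [h0] at this
      exact absurd hN (not_le.2 this))
  refine ⟨N + m, by omega, ?_, ?_⟩
  · have := Nat.find_spec hex
    rwa [hm] at this
  · exact not_lt.1 (Nat.find_min hex (by omega))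

end Dimension

/-- Lower bound for the Hausdorff dimension of the invariant measure of a circle
homeomorphism whose dynamical partitions satisfy the length lower bound
`|I| > M⁻ⁿ/(a_1⋯a_n)²`: if `α ∈ D_τ` then
`dim_H(μ) ≥ 1/(2τ + ν₁ + ν₂ log M)` with
`ν₁ = limsup 2 log(a_1⋯a_n)/log q_n` and `ν₂ = limsup n/log q_n`. -/
theorem stmt3 (H : CircleHomeo) (α : ℝ) (hirr : Irrational α)
    (hrot : HasRotationNumber H α) (μ : Measure Circle1)
    (hμ : IsInvProbMeasure H μ)
    (huniq : ∀ ν : Measure Circle1, IsInvProbMeasure H ν → ν = μ)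
    (x0 : Circle1) (τ : ℝ) (hτ : 0 ≤ τ) (hD : α ∈ DiophTau τ)
    (M : ℝ) (hM : 1 < M) (n0 : ℕ)
    (hlen : ∀ n ≥ n0, ∀ S ∈ DynPart.part H α x0 n,
      M ^ (-(n : ℝ)) / (∏ m ∈ Finset.Icc 1 n, (cfA α m : ℝ)) ^ 2 < (volume S).toReal) :
    ENNReal.ofReal (1 / (2 * τ
        + Filter.limsup (fun n : ℕ =>
            2 * Real.log (∏ m ∈ Finset.Icc 1 n, (cfA α m : ℝ)) / Real.log (cfQ α n))
            Filter.atTop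
        + Filter.limsup (fun n : ℕ => (n : ℝ) / Real.log (cfQ α n)) Filter.atTop
            * Real.log M))
      ≤ dimHMeasure μ := by
  obtain ⟨hα, β, hβα, hβ⟩ := hrot
  obtain ⟨hprob, hinv⟩ := hμ
  refine le_iInf fun X => le_iInf fun _ => le_iInf fun hX => ?_
  refine le_of_forall_lt fun c hc => ?_
  obtain ⟨s, hs, rfl⟩ : ∃ s : ℝ, 0 ≤ s ∧ ENNReal.ofReal s = c :=
    ⟨c.toReal, ENNReal.toReal_nonneg, ENNReal.ofReal_toReal (ne_top_of_lt hc)⟩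
  obtain ⟨s', hs', hs1⟩ := exists_between ((ENNReal.ofReal_lt_ofReal_iff_of_nonneg hs).1 hc)
  have hs0 : 0 < s' := hs.trans_lt hs'
  refine lt_of_lt_of_le ((ENNReal.ofReal_lt_ofReal_iff hs0).2 hs') ?_
  have hκ := one_div_pos.1 (hs0.trans hs1)
  obtain ⟨C, hC, hdecay⟩ := exists_one_div_cfQ_le_atomBound_rpow hirr hα hD hM hs0
    ((lt_div_iff₀ hκ).1 hs1)
  obtain ⟨N, hN⟩ := eventually_atTop.1 (hdecay.and (eventually_ge_atTop (n0 + 1)))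
  have hpos := atomBound_pos hirr hα hM
  refine ofReal_le_dimH_of_ceilAverage_le (μ := μ) (C := 2 * C * 2 ^ s') (r₀ := atomBound α M N / 2)
    hs0 (by positivity) (half_pos (hpos N)) (fun t r hr hrN => ?_) (by simp [hX])
  obtain ⟨n, hn, hn1, hn2⟩ := exists_succ_lt_le_of_tendsto_zero (tendsto_atomBound hirr hα hM)
    (show 0 < 2 * r by positivity) (show 2 * r ≤ atomBound α M N by linarith)
  obtain ⟨hq, hn0⟩ := hN n hn
  obtain ⟨m, rfl⟩ := Nat.exists_eq_add_of_le' (show 1 ≤ n by omega)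
  have hx0 := projC_circRep x0
  rw [← hx0] at hlen
  have h1 := ceilAverage_add_le hirr hα hβα hinv hβ (circRep x0) (hpos (m + 1))
    (hlen (m + 1) (by omega)) (t - r)
  have h2 : ceilAverage μ (t + r) ≤ ceilAverage μ (t - r + atomBound α M (m + 1)) :=
    ceilAverage_mono μ (by linarith)
  have h3 : atomBound α M (m + 1 + 1) ^ s' ≤ (2 * r) ^ s' :=
    Real.rpow_le_rpow (hpos _).le hn1.le hs0.le
  calc ceilAverage μ (t + r) - ceilAverage μ (t - r) ≤ 2 / cfQ α (m + 1) := by linarith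
    _ = 2 * (1 / cfQ α (m + 1)) := by ring
    _ ≤ 2 * (C * (2 * r) ^ s') := by gcongr; exact hq.trans (by gcongr)
    _ = 2 * C * 2 ^ s' * r ^ s' := by rw [Real.mul_rpow zero_le_two hr.le]; ring
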